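/- For λ ∉ [0,∞), the Stieltjes transform of the measure dτ with a unit point mass at 0 and density (1/π)·√s/(1+s) on (0,∞) equals m(λ) = -1/λ + 1/√(-λ) - 1/(-λ + √(-λ)). -/

import Mathlib

open MeasureTheory Real Set

/-- Branch of `√(-z)` holomorphic on `ℂ ∖ [0,∞)`, positive on `(-∞,0)`. -/
noncomputable def sqrtNeg (z : ℂ) : ℂ := Complex.exp (Complex.log (-z) / 2)

open Filter Topology

theorem sqrtNeg_sq {z : ℂ} (hz : z ≠ 0) : sqrtNeg z ^ 2 = -z := by
  rw [sqrtNeg, ← Complex.exp_nat_mul, Nat.cast_ofNat, mul_div_cancel₀ _ two_ne_zero,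
    Complex.exp_log (neg_ne_zero.2 hz)]

theorem sqrtNeg_re_pos {z : ℂ} (hz : -z ∈ Complex.slitPlane) : 0 < (sqrtNeg z).re := by
  have him : (Complex.log (-z) / 2).im = (-z).arg / 2 := by
    simp [Complex.log_im]
  rw [sqrtNeg, Complex.exp_re, him]
  have hlt : (-z).arg < π :=
    lt_of_le_of_ne (Complex.arg_le_pi _) (Complex.mem_slitPlane_iff_arg.1 hz).1
  have hgt := Complex.neg_pi_lt_arg (-z)
  exact mul_pos (Real.exp_pos _) (Real.cos_pos_of_mem_Ioo ⟨by linarith, by linarith⟩)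

theorem re_sq_le_norm_sq_add_sq (w : ℂ) (t : ℝ) : w.re ^ 2 ≤ ‖(t : ℂ) ^ 2 + w ^ 2‖ := by
  have hfac : (t : ℂ) ^ 2 + w ^ 2 = (w + t * Complex.I) * (w - t * Complex.I) := by
    linear_combination (t : ℂ) ^ 2 * Complex.I_sq
  have h₁ : |w.re| ≤ ‖w + t * Complex.I‖ := by
    simpa using Complex.abs_re_le_norm (w + t * Complex.I)
  have h₂ : |w.re| ≤ ‖w - t * Complex.I‖ := by
    simpa using Complex.abs_re_le_norm (w - t * Complex.I)
  rw [hfac, norm_mul, ← sq_abs, sq]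
  gcongr

theorem sq_add_sq_ne_zero {w : ℂ} (hw : 0 < w.re) (t : ℝ) : (t : ℂ) ^ 2 + w ^ 2 ≠ 0 :=
  norm_pos_iff.1 ((pow_pos hw 2).trans_le (re_sq_le_norm_sq_add_sq w t))

theorem one_add_sq_ne_zero (t : ℝ) : (1 : ℂ) + (t : ℂ) ^ 2 ≠ 0 := by
  exact_mod_cast (by positivity : (1 : ℝ) + t ^ 2 ≠ 0)

theorem integrable_sq_div {w : ℂ} (hw : 0 < w.re) :
    Integrable fun t : ℝ ↦ (t : ℂ) ^ 2 / ((1 + (t : ℂ) ^ 2) * ((t : ℂ) ^ 2 + w ^ 2)) := by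
  refine (integrable_inv_one_add_sq.const_mul (1 + ‖w ^ 2‖ / w.re ^ 2)).mono' ?_ ?_
  · refine Continuous.aestronglyMeasurable ?_
    exact Continuous.div (by fun_prop) (by fun_prop) fun t ↦
      mul_ne_zero (one_add_sq_ne_zero t) (sq_add_sq_ne_zero hw t)
  · refine Eventually.of_forall fun t ↦ ?_
    have hne := sq_add_sq_ne_zero hw t
    have hsplit : (t : ℂ) ^ 2 / ((1 + (t : ℂ) ^ 2) * ((t : ℂ) ^ 2 + w ^ 2)) =
        (1 - w ^ 2 / ((t : ℂ) ^ 2 + w ^ 2)) * (((1 + t ^ 2)⁻¹ : ℝ) : ℂ) := by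
      have := one_add_sq_ne_zero t
      push_cast
      field_simp
      ring
    rw [hsplit, norm_mul, Complex.norm_of_nonneg (by positivity : 0 ≤ (1 + t ^ 2)⁻¹)]
    gcongr
    refine (norm_sub_le _ _).trans ?_
    rw [norm_one, norm_div]
    gcongr
    exact re_sq_le_norm_sq_add_sq w t

/-- For `0 < w.re`, this is `arctan (t / w)`. -/
noncomputable def arctanDiv (w : ℂ) (t : ℝ) : ℂ :=
  (Complex.log (w + t * Complex.I) - Complex.log (w - t * Complex.I)) / (2 * Complex.I)

theorem hasDerivAt_arctanDiv {w : ℂ} (hw : 0 < w.re) (t : ℝ) :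
    HasDerivAt (arctanDiv w) (w / ((t : ℂ) ^ 2 + w ^ 2)) t := by
  have hlin : HasDerivAt (fun t : ℝ ↦ (t : ℂ) * Complex.I) Complex.I t := by
    simpa using Complex.ofRealCLM.hasDerivAt.mul_const Complex.I
  have hp : w + t * Complex.I ∈ Complex.slitPlane := Or.inl (by simpa using hw)
  have hm : w - t * Complex.I ∈ Complex.slitPlane := Or.inl (by simpa using hw)
  have hd := (((hlin.const_add w).clog_real hp).sub ((hlin.const_sub w).clog_real hm)).div_const
    (2 * Complex.I)
  refine hd.congr_deriv ?_
  have hsum (a b : ℂ) (ha : a ≠ 0) (hb : b ≠ 0) (hab : a + b = 2 * w) :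
      (Complex.I / a - -Complex.I / b) / (2 * Complex.I) = w / (a * b) := by
    field_simp
    linear_combination hab
  have hfac : (t : ℂ) ^ 2 + w ^ 2 = (w + t * Complex.I) * (w - t * Complex.I) := by
    linear_combination (t : ℂ) ^ 2 * Complex.I_sq
  rw [hfac]
  exact hsum _ _ (Complex.slitPlane_ne_zero hp) (Complex.slitPlane_ne_zero hm) (by ring)

theorem tendsto_arctanDiv (w : ℂ) : Tendsto (arctanDiv w) atTop (𝓝 (π / 2)) := by
  have hdiv : Tendsto (fun t : ℝ ↦ w * ((t⁻¹ : ℝ) : ℂ)) atTop (𝓝 0) := by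
    simpa using ((Complex.continuous_ofReal.tendsto 0).comp tendsto_inv_atTop_zero).const_mul w
  have hp := (hdiv.add_const Complex.I).clog (by simp [Complex.mem_slitPlane_iff])
  have hm := (hdiv.sub_const Complex.I).clog (by simp [Complex.mem_slitPlane_iff])
  have hlim := (hp.sub hm).div_const (2 * Complex.I)
  have hval : (Complex.log (0 + Complex.I) - Complex.log (0 - Complex.I)) / (2 * Complex.I) =
      π / 2 := by
    rw [zero_add, zero_sub, Complex.log_I, Complex.log_neg_I]
    field_simp
    ring
  rw [hval] at hlim
  refine hlim.congr' ?_
  have hne : ∀ c : ℂ, c ≠ 0 → ∀ᶠ t : ℝ in atTop, w * ((t⁻¹ : ℝ) : ℂ) + c ≠ 0 := fun c hc ↦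
    (hdiv.add_const c).eventually_ne (by simpa using hc)
  filter_upwards [eventually_gt_atTop 0, hne Complex.I Complex.I_ne_zero,
    hne (-Complex.I) (neg_ne_zero.2 Complex.I_ne_zero)] with t ht h₁ h₂
  have ht' : (t : ℂ) ≠ 0 := by exact_mod_cast ht.ne'
  have e₁ : w + t * Complex.I = t * (w * ((t⁻¹ : ℝ) : ℂ) + Complex.I) := by
    push_cast
    field_simp
  have e₂ : w - t * Complex.I = t * (w * ((t⁻¹ : ℝ) : ℂ) + -Complex.I) := by
    push_cast
    field_simp
    ring
  rw [arctanDiv, e₁, e₂, Complex.log_ofReal_mul ht h₁, Complex.log_ofReal_mul ht h₂,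
    add_sub_add_left_eq_sub, ← sub_eq_add_neg]

theorem arctanDiv_zero (w : ℂ) : arctanDiv w 0 = 0 := by
  simp [arctanDiv]

theorem tendsto_div_one_add_sq :
    Tendsto (fun t : ℝ ↦ (t : ℂ) / (1 + (t : ℂ) ^ 2)) atTop (𝓝 0) := by
  have hreal : Tendsto (fun t : ℝ ↦ t / (1 + t ^ 2)) atTop (𝓝 0) := by
    refine squeeze_zero' ?_ ?_ tendsto_inv_atTop_zero
    · filter_upwards [eventually_ge_atTop 0] with t ht
      positivity
    · filter_upwards [eventually_gt_atTop 0] with t ht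
      rw [inv_eq_one_div, div_le_div_iff₀ (by positivity) ht]
      nlinarith
  have := (Complex.continuous_ofReal.tendsto 0).comp hreal
  simpa [Function.comp_def] using this

theorem integral_sq_div {w : ℂ} (hw : 0 < w.re) :
    ∫ t in Ioi (0 : ℝ), (t : ℂ) ^ 2 / ((1 + (t : ℂ) ^ 2) * ((t : ℂ) ^ 2 + w ^ 2)) =
      π / (2 * (1 + w)) := by
  have hw1 : 1 + w ≠ 0 := fun h ↦ by
    have := congrArg Complex.re h
    simp at this
    linarith
  have h1 : (0 : ℝ) < (1 : ℂ).re := by simp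
  by_cases hw' : w = 1
  · subst hw'
    have hderiv (t : ℝ) : HasDerivAt
        (fun t : ℝ ↦ (arctanDiv 1 t - (t : ℂ) / (1 + (t : ℂ) ^ 2)) / 2)
        ((t : ℂ) ^ 2 / ((1 + (t : ℂ) ^ 2) * ((t : ℂ) ^ 2 + 1 ^ 2))) t := by
      have ht := one_add_sq_ne_zero t
      have hid : HasDerivAt (fun t : ℝ ↦ (t : ℂ)) 1 t := Complex.ofRealCLM.hasDerivAt
      have hd := ((hasDerivAt_arctanDiv h1 t).sub
        (hid.div ((hid.pow 2).const_add 1) ht)).div_const 2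
      refine hd.congr_deriv ?_
      simp only [Pi.pow_apply]
      rw [one_pow, add_comm _ (1 : ℂ)]
      field_simp
      ring
    have hlim := ((tendsto_arctanDiv 1).sub tendsto_div_one_add_sq).div_const 2
    rw [integral_Ioi_of_hasDerivAt_of_tendsto' (fun t _ ↦ hderiv t)
      (integrable_sq_div h1).integrableOn hlim]
    simp only [arctanDiv_zero, Complex.ofReal_zero]
    ring
  · have hsub : w ^ 2 - 1 ≠ 0 := by
      rw [show w ^ 2 - 1 = (w - 1) * (1 + w) by ring]
      exact mul_ne_zero (sub_ne_zero.2 hw') hw1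
    have hderiv (t : ℝ) : HasDerivAt
        (fun t : ℝ ↦ (w * arctanDiv w t - arctanDiv 1 t) / (w ^ 2 - 1))
        ((t : ℂ) ^ 2 / ((1 + (t : ℂ) ^ 2) * ((t : ℂ) ^ 2 + w ^ 2))) t := by
      have ht := one_add_sq_ne_zero t
      have htw := sq_add_sq_ne_zero hw t
      have hd := (((hasDerivAt_arctanDiv hw t).const_mul w).sub
        (hasDerivAt_arctanDiv h1 t)).div_const (w ^ 2 - 1)
      refine hd.congr_deriv ?_
      rw [one_pow, add_comm _ (1 : ℂ)]
      field_simp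
      ring
    have hlim := (((tendsto_arctanDiv w).const_mul w).sub (tendsto_arctanDiv 1)).div_const
      (w ^ 2 - 1)
    rw [integral_Ioi_of_hasDerivAt_of_tendsto' (fun t _ ↦ hderiv t)
      (integrable_sq_div hw).integrableOn hlim]
    simp only [arctanDiv_zero]
    field_simp
    ring

/-- For `λ ∉ [0,∞)`, the Stieltjes transform of the measure with a unit point mass at `0`
and density `(1/π)·√s/(1+s)` on `(0,∞)` equals `-1/λ + 1/√(-λ) - 1/(-λ+√(-λ))`. -/
theorem stmt_5 (z : ℂ) (hz : ∀ s : ℝ, 0 ≤ s → z ≠ (s : ℂ)) :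
    1 / (0 - z) +
        ∫ s in Ioi (0 : ℝ),
          (1 / ((s : ℂ) - z)) * (((1 / π) * (Real.sqrt s / (1 + s)) : ℝ) : ℂ) =
      -1 / z + 1 / sqrtNeg z - 1 / (-z + sqrtNeg z) := by
  have hz0 : z ≠ 0 := by simpa using hz 0 le_rfl
  have hslit : -z ∈ Complex.slitPlane := by
    rw [Complex.mem_slitPlane_iff]
    by_contra! h
    simp only [Complex.neg_re, Complex.neg_im, neg_eq_zero] at h
    exact hz z.re (by linarith [h.1]) (Complex.ext (by simp) (by simp [h.2]))
  have hw := sqrtNeg_re_pos hslit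
  have hsq := sqrtNeg_sq hz0
  set w := sqrtNeg z
  have hw0 : w ≠ 0 := fun h ↦ by simp [h] at hw
  have hw1 : 1 + w ≠ 0 := fun h ↦ by
    have := congrArg Complex.re h
    simp at this
    linarith
  have hint : ∫ s in Ioi (0 : ℝ),
      (1 / ((s : ℂ) - z)) * (((1 / π) * (Real.sqrt s / (1 + s)) : ℝ) : ℂ) = 1 / (1 + w) := by
    rw [← integral_comp_rpow_Ioi_of_pos two_pos]
    have hcongr : ∀ t ∈ Ioi (0 : ℝ),
        (2 * t ^ ((2 : ℝ) - 1)) • ((1 / (((t ^ (2 : ℝ) : ℝ) : ℂ) - z)) *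
          (((1 / π) * (Real.sqrt (t ^ (2 : ℝ)) / (1 + t ^ (2 : ℝ))) : ℝ) : ℂ)) =
        (2 / π : ℂ) * ((t : ℂ) ^ 2 / ((1 + (t : ℂ) ^ 2) * ((t : ℂ) ^ 2 + w ^ 2))) := by
      intro t ht
      have h₁ := one_add_sq_ne_zero t
      have h₂ := sq_add_sq_ne_zero hw t
      rw [hsq, ← sub_eq_add_neg] at h₂ ⊢
      rw [show (2 : ℝ) - 1 = 1 by norm_num, Real.rpow_one, Real.rpow_two,
        Real.sqrt_sq (le_of_lt ht), Complex.real_smul]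
      push_cast
      field_simp
    rw [setIntegral_congr_fun measurableSet_Ioi hcongr, integral_const_mul, integral_sq_div hw]
    have hpi : (π : ℂ) ≠ 0 := by exact_mod_cast Real.pi_ne_zero
    field_simp
  rw [hint, zero_sub, ← hsq, show w ^ 2 + w = w * (1 + w) by ring, hsq]
  field_simp
  ring
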